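/- arXiv:1903.05975 — 10 statements merged into one kernel-verified Lean document; each statement's English description precedes it below -/
import Mathlib

section
/- The complete preference profile on agents {1,2,3,4} given by: agent 1: 1 ∼ 2 ≻ 3 ≻ 4; agent 2: 1 ≻ 2 ≻ 4 ≻ 3; agent 3: 4 ≻ 2 ≻ 3 ≻ 1; agent 4: 4 ≻ 3 ≻ 2 ≻ 1, is single-crossing but is not tie-sensitive single-crossing (with respect to any linear order of the agents). Hence for preferences with ties, single-crossingness does not imply tie-sensitive single-crossingness. -/
/-!
Basic framework: preference profiles with possibly incomplete preferences and ties,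
structured-preference properties (narcissistic, single-peaked, single-crossing,
tie-sensitive single-crossing), matchings, blocking pairs and stability.
-/

/-- A preference profile: each agent `i` has a weak order `pref i` (transitive and
total) on its acceptable set `acc i`.  `pref i x y` means agent `i` weakly prefers
`x` to `y`. -/
structure Profile (V : Type*) where
  acc : V → Set V
  pref : V → V → V → Prop
  pref_mem : ∀ i x y, pref i x y → x ∈ acc i ∧ y ∈ acc i
  pref_total : ∀ i x y, x ∈ acc i → y ∈ acc i → pref i x y ∨ pref i y x
  pref_trans : ∀ i x y z, pref i x y → pref i y z → pref i x z

namespace Profile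

variable {V : Type*} (P : Profile V)

/-- `i` strictly prefers `x` to `y`. -/
def Strict (i x y : V) : Prop := P.pref i x y ∧ ¬ P.pref i y x

/-- `i` is indifferent between (ties) `x` and `y`. -/
def Indiff (i x y : V) : Prop := P.pref i x y ∧ P.pref i y x

/-- Acceptability is symmetric between distinct agents. -/
def AccSymm : Prop := ∀ i j : V, i ≠ j → (j ∈ P.acc i ↔ i ∈ P.acc j)

/-- The profile has no ties. -/
def NoTies : Prop := ∀ i x y : V, x ≠ y → ¬ P.Indiff i x y

/-- The profile is complete: `V(≽ᵢ) ∪ {i} = V` for every agent `i`. -/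
def IsComplete : Prop := ∀ i : V, P.acc i ∪ {i} = Set.univ

/-- The profile is narcissistic. -/
def Narcissistic : Prop :=
  ∀ i : V, i ∈ P.acc i ∧ ∀ j ∈ P.acc i, j ≠ i → P.Strict i i j

/-- The agents of a set `S` are narcissistic. -/
def NarcissisticOn (S : Set V) : Prop :=
  ∀ i ∈ S, i ∈ P.acc i ∧ ∀ j ∈ P.acc i, j ≠ i → P.Strict i i j

/-- `X ▷ Y` : every member of `X` strictly precedes every member of `Y` w.r.t. `lt`. -/
def SetBefore (lt : V → V → Prop) (X Y : Set V) : Prop :=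
  ∀ x ∈ X, ∀ y ∈ Y, lt x y

/-- `V[x ≻ y]`: the agents that find both `x` and `y` acceptable and strictly
prefer `x` to `y`. -/
def prefersSet (x y : V) : Set V :=
  {i | x ∈ P.acc i ∧ y ∈ P.acc i ∧ P.Strict i x y}

/-- `V[x ∼ y]`: the agents that find both `x` and `y` acceptable and are
indifferent between them. -/
def tiesSet (x y : V) : Set V :=
  {i | x ∈ P.acc i ∧ y ∈ P.acc i ∧ P.Indiff i x y}

/-- `V[x ≻ y]` restricted to the agents of `S`. -/
def prefersSetOn (S : Set V) (x y : V) : Set V :=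
  {i | i ∈ S ∧ x ∈ P.acc i ∧ y ∈ P.acc i ∧ P.Strict i x y}

/-- `V[x ∼ y]` restricted to the agents of `S`. -/
def tiesSetOn (S : Set V) (x y : V) : Set V :=
  {i | i ∈ S ∧ x ∈ P.acc i ∧ y ∈ P.acc i ∧ P.Indiff i x y}

/-- The profile is single-peaked with respect to the linear order `lt`. -/
def SinglePeakedWrt (lt : V → V → Prop) : Prop :=
  ∀ i x y z : V, x ∈ P.acc i → y ∈ P.acc i → z ∈ P.acc i →
    lt x y → lt y z → P.Strict i x y → P.pref i y z

/-- The profile is single-peaked. -/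
def SinglePeaked : Prop :=
  ∃ lt : V → V → Prop, IsStrictTotalOrder V lt ∧ P.SinglePeakedWrt lt

/-- The preferences of the agents of `S` are single-peaked w.r.t. `lt`. -/
def SinglePeakedWrtOn (S : Set V) (lt : V → V → Prop) : Prop :=
  ∀ i ∈ S, ∀ x y z : V, x ∈ P.acc i → y ∈ P.acc i → z ∈ P.acc i →
    lt x y → lt y z → P.Strict i x y → P.pref i y z

/-- The profile is tie-sensitive single-crossing with respect to `lt`:
for each pair `{x, y}` of distinct agents either
`V[x ≻ y] ▷ V[x ∼ y] ▷ V[y ≻ x]` or `V[y ≻ x] ▷ V[x ∼ y] ▷ V[x ≻ y]`. -/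
def TSSingleCrossingWrt (lt : V → V → Prop) : Prop :=
  ∀ x y : V, x ≠ y →
    (SetBefore lt (P.prefersSet x y) (P.tiesSet x y) ∧
     SetBefore lt (P.tiesSet x y) (P.prefersSet y x) ∧
     SetBefore lt (P.prefersSet x y) (P.prefersSet y x)) ∨
    (SetBefore lt (P.prefersSet y x) (P.tiesSet x y) ∧
     SetBefore lt (P.tiesSet x y) (P.prefersSet x y) ∧
     SetBefore lt (P.prefersSet y x) (P.prefersSet x y))

/-- The profile is tie-sensitive single-crossing. -/
def TSSingleCrossing : Prop :=
  ∃ lt : V → V → Prop, IsStrictTotalOrder V lt ∧ P.TSSingleCrossingWrt lt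

/-- Tie-sensitive single-crossingness of the preferences of the agents of `S`. -/
def TSSingleCrossingWrtOn (S : Set V) (lt : V → V → Prop) : Prop :=
  ∀ x y : V, x ≠ y →
    (SetBefore lt (P.prefersSetOn S x y) (P.tiesSetOn S x y) ∧
     SetBefore lt (P.tiesSetOn S x y) (P.prefersSetOn S y x) ∧
     SetBefore lt (P.prefersSetOn S x y) (P.prefersSetOn S y x)) ∨
    (SetBefore lt (P.prefersSetOn S y x) (P.tiesSetOn S x y) ∧
     SetBefore lt (P.tiesSetOn S x y) (P.prefersSetOn S x y) ∧
     SetBefore lt (P.prefersSetOn S y x) (P.prefersSetOn S x y))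

/-- `ext` is a linear extension of the profile: for every agent `i`, `ext i` is a
strict linear order on the acceptable set `acc i` that contains `Strict i`. -/
def IsLinearExt (ext : V → V → V → Prop) : Prop :=
  (∀ i x y, ext i x y → x ∈ P.acc i ∧ y ∈ P.acc i) ∧
  (∀ i x, ¬ ext i x x) ∧
  (∀ i x y z, ext i x y → ext i y z → ext i x z) ∧
  (∀ i x y, x ∈ P.acc i → y ∈ P.acc i → x ≠ y → (ext i x y ∨ ext i y x)) ∧
  (∀ i x y, ext i x y → ¬ ext i y x) ∧
  (∀ i x y, P.Strict i x y → ext i x y)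

/-- `V[x ≻' y]` for a linear extension `ext`. -/
def extPrefersSet (ext : V → V → V → Prop) (x y : V) : Set V :=
  {i | x ∈ P.acc i ∧ y ∈ P.acc i ∧ ext i x y}

/-- The linear extension `ext` witnesses single-crossingness w.r.t. `lt`. -/
def SingleCrossingWrtVia (ext : V → V → V → Prop) (lt : V → V → Prop) : Prop :=
  ∀ x y : V, x ≠ y →
    SetBefore lt (P.extPrefersSet ext x y) (P.extPrefersSet ext y x) ∨
    SetBefore lt (P.extPrefersSet ext y x) (P.extPrefersSet ext x y)

/-- The profile is single-crossing with respect to `lt`: some linear extension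
of the profile crosses each pair at most once along `lt`. -/
def SingleCrossingWrt (lt : V → V → Prop) : Prop :=
  ∃ ext : V → V → V → Prop, P.IsLinearExt ext ∧ P.SingleCrossingWrtVia ext lt

/-- The profile is single-crossing. -/
def SingleCrossing : Prop :=
  ∃ lt : V → V → Prop, IsStrictTotalOrder V lt ∧ P.SingleCrossingWrt lt

/-- Single-crossingness w.r.t. `lt` for profiles without ties, stated directly via
the strict preferences. -/
def SCNoTiesWrt (lt : V → V → Prop) : Prop :=
  ∀ x y : V, x ≠ y →
    SetBefore lt (P.prefersSet x y) (P.prefersSet y x) ∨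
    SetBefore lt (P.prefersSet y x) (P.prefersSet x y)

/-- `x` is a most acceptable agent of `y`. -/
def MostAcceptable (x y : V) : Prop :=
  x ∈ P.acc y ∧ x ≠ y ∧ ∀ z ∈ P.acc y, z ≠ x → z ≠ y → P.pref y x z

/-- A matching: a set of pairwise disjoint pairs of distinct, mutually acceptable
agents, encoded by the partner function `m` (`m x = none` iff `x` is unmatched). -/
structure Matching (Q : Profile V) where
  m : V → Option V
  ne : ∀ x y, m x = some y → x ≠ y
  mutual_acc : ∀ x y, m x = some y → y ∈ Q.acc x ∧ x ∈ Q.acc y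
  symm : ∀ x y, m x = some y → m y = some x

/-- The (mutually acceptable, unmatched) pair `{x, y}` blocks the matching `M`. -/
def Matching.Blocks {Q : Profile V} (M : Q.Matching) (x y : V) : Prop :=
  x ≠ y ∧ y ∈ Q.acc x ∧ x ∈ Q.acc y ∧ M.m x ≠ some y ∧
  (∀ z, M.m x = some z → Q.Strict x y z) ∧
  (∀ z, M.m y = some z → Q.Strict y x z)

/-- A matching is stable if no pair blocks it. -/
def Matching.Stable {Q : Profile V} (M : Q.Matching) : Prop :=
  ∀ x y : V, ¬ M.Blocks x y

/-- A matching is perfect if every agent is matched. -/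
def Matching.Perfect {Q : Profile V} (M : Q.Matching) : Prop :=
  ∀ x : V, M.m x ≠ none

/-- Build a profile from ranking functions (`none` = unacceptable, smaller rank =
more preferred). -/
def ofRank {V : Type*} (rk : V → V → Option ℕ) : Profile V where
  acc i := {x | rk i x ≠ none}
  pref i x y := ∃ a b : ℕ, rk i x = some a ∧ rk i y = some b ∧ a ≤ b
  pref_mem i x y := by
    rintro ⟨a, b, ha, hb, -⟩
    constructor <;> simp only [Set.mem_setOf_eq, ha, hb] <;> simp
  pref_total i x y hx hy := by
    obtain ⟨a, ha⟩ := Option.ne_none_iff_exists'.mp hx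
    obtain ⟨b, hb⟩ := Option.ne_none_iff_exists'.mp hy
    rcases le_total a b with h | h
    · exact Or.inl ⟨a, b, ha, hb, h⟩
    · exact Or.inr ⟨b, a, hb, ha, h⟩
  pref_trans i x y z := by
    rintro ⟨a, b, ha, hb, hab⟩ ⟨b', c, hb', hc, hbc⟩
    refine ⟨a, c, ha, hc, hab.trans ?_⟩
    rw [hb] at hb'
    rwa [Option.some_inj.mp hb']

end Profile

/-- The rank table of the profile: agent 1: 1 ∼ 2 ≻ 3 ≻ 4; agent 2: 1 ≻ 2 ≻ 4 ≻ 3;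
agent 3: 4 ≻ 2 ≻ 3 ≻ 1; agent 4: 4 ≻ 3 ≻ 2 ≻ 1 (agent `i` is index `i - 1`). -/
def scNotTsscRank : Fin 4 → Fin 4 → Option ℕ :=
  ![![some 0, some 0, some 1, some 2],
    ![some 0, some 1, some 3, some 2],
    ![some 3, some 1, some 2, some 0],
    ![some 3, some 2, some 1, some 0]]

namespace Profile

variable {V : Type*} (r : V → V → ℕ)

theorem mem_acc_ofRank_some (i x : V) : x ∈ (ofRank fun i x => some (r i x)).acc i := by
  simp [ofRank]

theorem pref_ofRank_some (i x y : V) :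
    (ofRank fun i x => some (r i x)).pref i x y ↔ r i x ≤ r i y := by
  simp [ofRank]

theorem strict_ofRank_some (i x y : V) :
    (ofRank fun i x => some (r i x)).Strict i x y ↔ r i x < r i y := by
  simp only [Strict, pref_ofRank_some]
  omega

theorem indiff_ofRank_some (i x y : V) :
    (ofRank fun i x => some (r i x)).Indiff i x y ↔ r i x = r i y := by
  simp only [Indiff, pref_ofRank_some]
  omega

theorem mem_prefersSet_ofRank_some (i x y : V) :
    i ∈ (ofRank fun i x => some (r i x)).prefersSet x y ↔ r i x < r i y := by
  simp [prefersSet, mem_acc_ofRank_some, strict_ofRank_some]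

theorem mem_tiesSet_ofRank_some (i x y : V) :
    i ∈ (ofRank fun i x => some (r i x)).tiesSet x y ↔ r i x = r i y := by
  simp [tiesSet, mem_acc_ofRank_some, indiff_ofRank_some]

/-- A profile of ranks is single-crossing as soon as some injective ranks refining it cross
each pair at most once along a strict total order. -/
theorem singleCrossing_ofRank_some (s : V → V → ℕ) (lt : V → V → Prop)
    (hlt : IsStrictTotalOrder V lt) (hinj : ∀ i, Function.Injective (s i))
    (href : ∀ i x y, r i x < r i y → s i x < s i y)
    (hcross : ∀ x y, (∀ i, s i x < s i y → ∀ j, s j y < s j x → lt i j) ∨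
      (∀ i, s i y < s i x → ∀ j, s j x < s j y → lt i j)) :
    (ofRank fun i x => some (r i x)).SingleCrossing := by
  refine ⟨lt, hlt, fun i x y => s i x < s i y, ⟨?_, ?_, ?_, ?_, ?_, ?_⟩, ?_⟩
  · exact fun i x y _ => ⟨mem_acc_ofRank_some r i x, mem_acc_ofRank_some r i y⟩
  · exact fun i x => lt_irrefl _
  · exact fun i x y z => lt_trans
  · exact fun i x y _ _ h => lt_or_gt_of_ne ((hinj i).ne h)
  · exact fun i x y => lt_asymm
  · exact fun i x y h => href i x y ((strict_ofRank_some r i x y).1 h)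
  · intro x y _
    exact (hcross x y).imp (fun h i hi j hj => h i hi.2.2 j hj.2.2)
      (fun h i hi j hj => h i hi.2.2 j hj.2.2)

end Profile

/-- The ranks in `scNotTsscRank`, all of which are defined. -/
def scNotTsscNatRank : Fin 4 → Fin 4 → ℕ :=
  ![![0, 0, 1, 2], ![0, 1, 3, 2], ![3, 1, 2, 0], ![3, 2, 1, 0]]

/-- The ranks in `scNotTsscRank` with the tie of agent 1 broken as 1 ≻ 2. -/
def scNotTsscLinearRank : Fin 4 → Fin 4 → ℕ :=
  ![![0, 1, 2, 3], ![0, 1, 3, 2], ![3, 1, 2, 0], ![3, 2, 1, 0]]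

theorem scNotTsscRank_eq : scNotTsscRank = fun i x => some (scNotTsscNatRank i x) := by
  decide

/-- The complete profile on four agents given by
agent 1: 1 ∼ 2 ≻ 3 ≻ 4; agent 2: 1 ≻ 2 ≻ 4 ≻ 3; agent 3: 4 ≻ 2 ≻ 3 ≻ 1;
agent 4: 4 ≻ 3 ≻ 2 ≻ 1 is single-crossing but not tie-sensitive single-crossing.
Hence for preferences with ties single-crossingness does not imply tie-sensitive
single-crossingness. -/
theorem sc_not_tssc_example :
    (Profile.ofRank scNotTsscRank).IsComplete ∧
    (Profile.ofRank scNotTsscRank).SingleCrossing ∧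
    ¬ (Profile.ofRank scNotTsscRank).TSSingleCrossing := by
  rw [scNotTsscRank_eq]
  refine ⟨fun i => Set.eq_univ_of_forall fun x => Or.inl (Profile.mem_acc_ofRank_some _ i x),
    Profile.singleCrossing_ofRank_some _ scNotTsscLinearRank (· < ·) inferInstance
      (by decide) (by decide) (by decide), ?_⟩
  rintro ⟨lt, hlt, h⟩
  have tie : (0 : Fin 4) ∈ (Profile.ofRank fun i x => some (scNotTsscNatRank i x)).tiesSet 0 1 :=
    (Profile.mem_tiesSet_ofRank_some _ _ _ _).2 (by decide)
  have prefers (i x y : Fin 4) (hr : scNotTsscNatRank i x < scNotTsscNatRank i y) :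
      i ∈ (Profile.ofRank fun i x => some (scNotTsscNatRank i x)).prefersSet x y :=
    (Profile.mem_prefersSet_ofRank_some _ _ _ _).2 hr
  -- Agent 1 is between agents 2 and 3 by the pair {1, 2}, but on one side of both by {3, 4}.
  have between : (lt 1 0 ∧ lt 0 2) ∨ (lt 2 0 ∧ lt 0 1) :=
    (h 0 1 (by decide)).imp
      (fun ⟨h₁, h₂, _⟩ =>
        ⟨h₁ 1 (prefers 1 0 1 (by decide)) 0 tie, h₂ 0 tie 2 (prefers 2 1 0 (by decide))⟩)
      (fun ⟨h₁, h₂, _⟩ =>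
        ⟨h₁ 2 (prefers 2 1 0 (by decide)) 0 tie, h₂ 0 tie 1 (prefers 1 0 1 (by decide))⟩)
  have outside : (lt 0 1 ∧ lt 0 2) ∨ (lt 1 0 ∧ lt 2 0) := by
    have h0 := prefers 0 2 3 (by decide)
    have h1 := prefers 1 3 2 (by decide)
    have h2 := prefers 2 3 2 (by decide)
    exact (h 2 3 (by decide)).imp (fun ⟨_, _, h₃⟩ => ⟨h₃ 0 h0 1 h1, h₃ 0 h0 2 h2⟩)
      (fun ⟨_, _, h₃⟩ => ⟨h₃ 1 h1 0 h0, h₃ 2 h2 0 h0⟩)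
  have h01 : lt 0 1 → ¬ lt 1 0 := asymm
  have h02 : lt 0 2 → ¬ lt 2 0 := asymm
  tauto
end

section
/- Let P be a complete and narcissistic preference profile (ties allowed). If P is single-crossing with respect to a linear order ▷ on the agent set, then P is single-peaked with respect to the same order ▷. -/
namespace Profile

/-- If `x` precedes `y`, an agent strictly preferring `x` to `y` precedes `y`, and an agent
strictly preferring `y` to `x` comes after `x`. -/
theorem SingleCrossingWrt.lt_of_strict {V : Type*} {P : Profile V} (hc : P.IsComplete)
    (hn : P.Narcissistic) {lt : V → V → Prop} (hlt : IsStrictTotalOrder V lt)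
    (hsc : P.SingleCrossingWrt lt) {x y i : V} (hxy : lt x y) :
    (P.Strict i x y → lt i y) ∧ (P.Strict i y x → lt x i) := by
  obtain ⟨ext, ⟨-, -, -, -, -, hext⟩, hvia⟩ := hsc
  have hacc : ∀ a b, b ∈ P.acc a := fun a b => by
    by_cases hba : b = a
    · exact hba ▸ (hn b).1
    · exact ((hc a).symm ▸ Set.mem_univ b : b ∈ P.acc a ∪ {a}).resolve_right hba
  have hne : x ≠ y := fun h => hlt.irrefl y (h ▸ hxy)
  have hx : x ∈ P.extPrefersSet ext x y :=
    ⟨hacc _ _, hacc _ _, hext _ _ _ ((hn x).2 y (hacc _ _) hne.symm)⟩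
  have hy : y ∈ P.extPrefersSet ext y x :=
    ⟨hacc _ _, hacc _ _, hext _ _ _ ((hn y).2 x (hacc _ _) hne)⟩
  rcases hvia x y hne with h | h
  · exact ⟨fun hi => h i ⟨hacc _ _, hacc _ _, hext _ _ _ hi⟩ y hy,
      fun hi => h x hx i ⟨hacc _ _, hacc _ _, hext _ _ _ hi⟩⟩
  · exact absurd (hlt.trans _ _ _ hxy (h y hy x hx)) (hlt.irrefl x)

end Profile

/-- A complete (possibly with ties) and narcissistic profile that is
single-crossing with respect to a linear order `lt` is also single-peaked with
respect to the same order `lt`. -/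
theorem singlePeaked_of_complete_narcissistic_singleCrossing {V : Type*} [Fintype V]
    (P : Profile V) (hc : P.IsComplete) (hn : P.Narcissistic)
    (lt : V → V → Prop) (hlt : IsStrictTotalOrder V lt)
    (hsc : P.SingleCrossingWrt lt) :
    P.SinglePeakedWrt lt := by
  intro i x y z _ hy hz hxy hyz hixy
  by_contra hiyz
  have hizy : P.Strict i z y := ⟨(P.pref_total i y z hy hz).resolve_left hiyz, hiyz⟩
  have hiy : lt i y := (hsc.lt_of_strict hc hn hlt hxy).1 hixy
  have hyi : lt y i := (hsc.lt_of_strict hc hn hlt hyz).2 hizy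
  exact hlt.irrefl y (hlt.trans _ _ _ hyi hiy)
end

section
/- If a preference profile on at least two agents is complete (ties allowed), narcissistic, and single-peaked, then there exist two distinct agents i and j such that i is a most acceptable agent of j and j is a most acceptable agent of i. -/
namespace Profile

theorem IsComplete.mem_acc {V : Type*} {P : Profile V} (hc : P.IsComplete) {i j : V}
    (hij : j ≠ i) : j ∈ P.acc i := by
  have h : j ∈ P.acc i ∪ {i} := hc i ▸ Set.mem_univ j
  exact h.resolve_right hij

section LinearOrder

variable {V : Type*} [LinearOrder V] (P : Profile V)

theorem pref_of_lt_of_lt (hacc : ∀ {i j}, j ≠ i → j ∈ P.acc i) (hn : P.Narcissistic)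
    (hsp : P.SinglePeakedWrt (· < ·)) {i y z : V} (hiy : i < y) (hyz : y < z) :
    P.pref i y z :=
  hsp i i y z (hn i).1 (hacc hiy.ne') (hacc (hiy.trans hyz).ne') hiy hyz
    ((hn i).2 y (hacc hiy.ne') hiy.ne')

theorem pref_of_gt_of_gt (hacc : ∀ {i j}, j ≠ i → j ∈ P.acc i) (hn : P.Narcissistic)
    (hsp : P.SinglePeakedWrt (· < ·)) {i y z : V} (hyi : y < i) (hzy : z < y) :
    P.pref i y z := by
  have hy := hacc hyi.ne
  have hz := hacc (hzy.trans hyi).ne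
  by_contra h
  exact ((hn i).2 y hy hyi.ne).2
    (hsp i z y i hz hy (hn i).1 hzy hyi ⟨(P.pref_total i y z hy hz).resolve_left h, h⟩)

/-- Some neighbour of `i` in the single-peaked order is a most acceptable agent of `i`. -/
theorem exists_covBy_mostAcceptable [Finite V] [Nontrivial V]
    (hacc : ∀ {i j}, j ≠ i → j ∈ P.acc i) (hn : P.Narcissistic)
    (hsp : P.SinglePeakedWrt (· < ·)) (i : V) :
    (∃ p, p ⋖ i ∧ P.MostAcceptable p i) ∨ ∃ s, i ⋖ s ∧ P.MostAcceptable s i := by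
  have hleft {p z : V} (hp : p ⋖ i) (hzp : z ≠ p) (hzi : z < i) : P.pref i p z :=
    P.pref_of_gt_of_gt hacc hn hsp hp.lt ((hp.le_of_lt hzi).lt_of_ne hzp)
  have hright {s z : V} (hs : i ⋖ s) (hzs : z ≠ s) (hiz : i < z) : P.pref i s z :=
    P.pref_of_lt_of_lt hacc hn hsp hs.lt ((hs.ge_of_gt hiz).lt_of_ne hzs.symm)
  by_cases hmin : IsMin i
  · have hmax : ¬ IsMax i := fun hmax => by
      obtain ⟨j, hj⟩ := exists_ne i
      exact hj.lt_or_gt.elim hmin.not_lt hmax.not_lt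
    obtain ⟨s, hs⟩ := exists_covBy_of_wellFoundedLT hmax
    refine .inr ⟨s, hs, hacc hs.lt.ne', hs.lt.ne', fun z _ hzs hzi => ?_⟩
    exact hright hs hzs (hzi.lt_or_gt.resolve_left hmin.not_lt)
  obtain ⟨p, hp⟩ := exists_covBy_of_wellFoundedGT hmin
  by_cases hmax : IsMax i
  · refine .inl ⟨p, hp, hacc hp.lt.ne, hp.lt.ne, fun z _ hzp hzi => ?_⟩
    exact hleft hp hzp (hzi.lt_or_gt.resolve_right hmax.not_lt)
  obtain ⟨s, hs⟩ := exists_covBy_of_wellFoundedLT hmax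
  rcases P.pref_total i p s (hacc hp.lt.ne) (hacc hs.lt.ne') with hps | hsp_le
  · refine .inl ⟨p, hp, hacc hp.lt.ne, hp.lt.ne, fun z _ hzp hzi => ?_⟩
    rcases hzi.lt_or_gt with hz | hz
    · exact hleft hp hzp hz
    · rcases eq_or_ne z s with rfl | hzs
      · exact hps
      · exact P.pref_trans i p s z hps (hright hs hzs hz)
  · refine .inr ⟨s, hs, hacc hs.lt.ne', hs.lt.ne', fun z _ hzs hzi => ?_⟩
    rcases hzi.lt_or_gt with hz | hz
    · rcases eq_or_ne z p with rfl | hzp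
      · exact hsp_le
      · exact P.pref_trans i s p z hsp_le (hleft hp hzp hz)
    · exact hright hs hzs hz

end LinearOrder

end Profile

/-- In every complete (possibly with ties), narcissistic and
single-peaked profile on at least two agents there are two distinct agents that are
each other's most acceptable agents. -/
theorem exists_mutually_most_acceptable {V : Type*} [Fintype V]
    (h2 : 1 < Fintype.card V) (P : Profile V)
    (hc : P.IsComplete) (hn : P.Narcissistic) (hsp : P.SinglePeaked) :
    ∃ i j : V, i ≠ j ∧ P.MostAcceptable i j ∧ P.MostAcceptable j i := by
  obtain ⟨lt, hlt, hsp⟩ := hsp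
  classical
  let _ : LinearOrder V := linearOrderOfSTO lt
  have : Nonempty V := Fintype.card_pos_iff.mp (by omega)
  have : Nontrivial V := Fintype.one_lt_card_iff_nontrivial.mp h2
  have hdich := P.exists_covBy_mostAcceptable hc.mem_acc hn hsp
  obtain ⟨m, hm⟩ := Finite.exists_max (id : V → V)
  obtain ⟨i, ⟨p, hpi, hp⟩, hmin⟩ :=
    WellFounded.has_min (wellFounded_lt (α := V))
      {i | ∃ p, p ⋖ i ∧ P.MostAcceptable p i}
      ⟨m, (hdich m).resolve_right fun ⟨s, hs, _⟩ => (hm s).not_gt hs.lt⟩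
  obtain ⟨s, hps, hs⟩ := (hdich p).resolve_left fun h => hmin p h hpi.lt
  obtain rfl : s = i := hps.unique_right hpi
  exact ⟨p, s, hpi.lt.ne, hp, hs⟩
end

section
/- Let P be a preference profile with complete preferences on an agent set V and let M be a stable matching for P. Let P' be a preference profile on V ∪ {x, y} (where x, y ∉ V are two new distinct agents) with complete preferences such that: the restriction of each agent i ∈ V's preference order in P' to V equals its preference order in P; agent y is a most acceptable agent of x in P'; and agent x is a most acceptable agent of y in P'. Then the matching M ∪ {{x, y}} is stable for P'. -/
namespace Profile

/-- No agent other than `y` is strictly preferred by `y` to a most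
acceptable agent. -/
theorem MostAcceptable.not_strict {V : Type*} {P : Profile V} {x y z : V}
    (h : P.MostAcceptable x y) (hzy : z ≠ y) : ¬ P.Strict y z x := by
  rintro ⟨hp, hn⟩
  by_cases hzx : z = x
  · subst hzx
    exact hn hp
  · exact hn (h.2.2 z (P.pref_mem _ _ _ hp).1 hzx hzy)

/-- Extend a matching on `V` to `V ⊕ Bool` by matching the two new agents with each other. -/
def Matching.augment {V : Type*} {P : Profile V} {P' : Profile (V ⊕ Bool)} (M : P.Matching)
    (hacc : ∀ i x : V, Sum.inl x ∈ P'.acc (Sum.inl i) ↔ x ∈ P.acc i)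
    (hft : Sum.inr false ∈ P'.acc (Sum.inr true))
    (htf : Sum.inr true ∈ P'.acc (Sum.inr false)) : P'.Matching where
  m := Sum.elim (fun v => (M.m v).map Sum.inl) (fun b => some (Sum.inr !b))
  ne := by
    rintro (v | b) (w | c) h
    · have hvw : M.m v = some w := by simpa using h
      simpa using M.ne v w hvw
    · simp
    · simp
    · cases b <;> cases c <;> simp_all
  mutual_acc := by
    rintro (v | b) (w | c) h
    · have hvw : M.m v = some w := by simpa using h
      simpa only [hacc] using M.mutual_acc v w hvw
    · simp at h
    · simp at h
    · cases b <;> cases c <;> simp_all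
  symm := by
    rintro (v | b) (w | c) h
    · have hvw : M.m v = some w := by simpa using h
      simp [M.symm v w hvw]
    · simp at h
    · simp at h
    · cases b <;> cases c <;> simp_all

end Profile

/-- Let `P` be a profile with complete preferences on `V` and `M` a
stable matching for `P`.  Let `P'` be a complete profile on `V` plus two new agents
`x = Sum.inr true` and `y = Sum.inr false` such that the preferences of every old
agent restricted to `V` agree with `P`, `y` is a most acceptable agent of `x`, and
`x` is a most acceptable agent of `y`.  Then `M ∪ {{x, y}}` is a stable matching
for `P'`. -/
theorem stable_of_augment_mutually_most_acceptable {V : Type*} [Fintype V]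
    (P : Profile V) (P' : Profile (V ⊕ Bool))
    (hPc : P.IsComplete) (hP'c : P'.IsComplete)
    (hacc : ∀ i x : V, Sum.inl x ∈ P'.acc (Sum.inl i) ↔ x ∈ P.acc i)
    (hpref : ∀ i x y : V,
      P'.pref (Sum.inl i) (Sum.inl x) (Sum.inl y) ↔ P.pref i x y)
    (hx : P'.MostAcceptable (Sum.inr false) (Sum.inr true))
    (hy : P'.MostAcceptable (Sum.inr true) (Sum.inr false))
    (M : P.Matching) (hM : M.Stable) :
    ∃ M' : P'.Matching,
      (∀ v : V, M'.m (Sum.inl v) = (M.m v).map Sum.inl) ∧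
      M'.m (Sum.inr true) = some (Sum.inr false) ∧
      M'.m (Sum.inr false) = some (Sum.inr true) ∧
      M'.Stable := by
  have hnew (b : Bool) : P'.MostAcceptable (Sum.inr !b) (Sum.inr b) := by
    cases b
    exacts [hy, hx]
  refine ⟨M.augment hacc hx.1 hy.1, fun _ => rfl, rfl, rfl, ?_⟩
  rintro (v | b) (w | c) ⟨hne, hw, hv, hm, hsv, hsw⟩
  · refine hM v w ⟨by simpa using hne, (hacc v w).1 hw, (hacc w v).1 hv, fun h => hm ?_,
      fun z hz => ?_, fun z hz => ?_⟩
    · simp [Profile.Matching.augment, h]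
    · simpa only [Profile.Strict, hpref] using
        hsv (Sum.inl z) (by simp [Profile.Matching.augment, hz])
    · simpa only [Profile.Strict, hpref] using
        hsw (Sum.inl z) (by simp [Profile.Matching.augment, hz])
  · exact (hnew c).not_strict hne (hsw _ rfl)
  · exact (hnew b).not_strict hne.symm (hsv _ rfl)
  · exact (hnew b).not_strict hne.symm (hsv _ rfl)
end

section
/- Every preference profile on 2n agents that is complete (ties allowed), narcissistic, and single-crossing admits a perfect stable matching; the same holds if the profile is complete, narcissistic, and tie-sensitive single-crossing. -/
namespace Profile

variable {V : Type*} {P : Profile V}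

theorem Strict.not_pref {i x y : V} (h : P.Strict i x y) : ¬ P.pref i y x := h.2

theorem acc_eq_univ (hc : P.IsComplete) (hn : P.Narcissistic) (i x : V) : x ∈ P.acc i := by
  have hx : x ∈ P.acc i ∪ {i} := hc i ▸ Set.mem_univ x
  rcases hx with hx | rfl
  · exact hx
  · exact (hn x).1

theorem SingleCrossingWrt.scNoTiesWrt {lt : V → V → Prop} (h : P.SingleCrossingWrt lt) :
    P.SCNoTiesWrt lt := by
  obtain ⟨ext, ⟨-, -, -, -, -, hext⟩, hsc⟩ := h
  have hsub : ∀ x y, P.prefersSet x y ⊆ P.extPrefersSet ext x y :=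
    fun x y i hi => ⟨hi.1, hi.2.1, hext i x y hi.2.2⟩
  intro x y hxy
  refine (hsc x y hxy).imp ?_ ?_ <;>
    exact fun h u hu v hv => h u (hsub _ _ hu) v (hsub _ _ hv)

theorem TSSingleCrossingWrt.scNoTiesWrt {lt : V → V → Prop} (h : P.TSSingleCrossingWrt lt) :
    P.SCNoTiesWrt lt :=
  fun x y hxy => (h x y hxy).imp (fun h => h.2.2) (fun h => h.2.2)

/-- If `y` lies between `a` and `z` in a crossing order of a narcissistic profile,
then `a` weakly prefers `y` to `z`. -/
theorem SCNoTiesWrt.pref_of_between {lt : V → V → Prop} [IsStrictTotalOrder V lt]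
    (hacc : ∀ i x, x ∈ P.acc i) (hn : P.Narcissistic) (hsc : P.SCNoTiesWrt lt) {a y z : V}
    (h : lt a y ∧ lt y z ∨ lt z y ∧ lt y a) : P.pref a y z := by
  by_contra hyz
  have hzy : P.pref a z y := (P.pref_total a z y (hacc _ _) (hacc _ _)).resolve_right hyz
  have hne : y ≠ z := by
    rintro rfl
    exact hyz hzy
  have ha : a ∈ P.prefersSet z y := ⟨hacc _ _, hacc _ _, hzy, hyz⟩
  have hy : y ∈ P.prefersSet y z := ⟨hacc _ _, hacc _ _, (hn y).2 z (hacc _ _) hne.symm⟩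
  have hz : z ∈ P.prefersSet z y := ⟨hacc _ _, hacc _ _, (hn z).2 y (hacc _ _) hne⟩
  rcases hsc y z hne with hb | hb
  · have h₁ := hb y hy a ha
    have h₂ := hb y hy z hz
    rcases h with h | h
    · exact asymm_of lt h₁ h.1
    · exact asymm_of lt h₂ h.1
  · have h₁ := hb a ha y hy
    have h₂ := hb z hz y hy
    rcases h with h | h
    · exact asymm_of lt h₂ h.2
    · exact asymm_of lt h₁ h.2

/-- If everybody weakly prefers closer agents on each side, every set of at least two agents
contains a pair of agents that are mutually top-ranked. -/
theorem exists_mutual_top [LinearOrder V] (hacc : ∀ i x, x ∈ P.acc i)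
    (hR : ∀ a y z, a < y → y < z → P.pref a y z) (hL : ∀ a y z, z < y → y < a → P.pref a y z)
    {S : Finset V} (hS : 1 < S.card) :
    ∃ a ∈ S, ∃ b ∈ S, a ≠ b ∧ (∀ z ∈ S, z ≠ a → P.pref a b z) ∧
      (∀ z ∈ S, z ≠ b → P.pref b a z) := by
  have hrefl : ∀ i x, P.pref i x x := fun i x => (P.pref_total i x x (hacc _ _) (hacc _ _)).elim id id
  have hpred : ∀ a, ∀ x ∈ S, x < a → ∃ p ∈ S, p < a ∧ (∀ w ∈ S, w < a → w ≤ p) ∧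
      ∀ w ∈ S, w < a → P.pref a p w := by
    intro a x hx hxa
    obtain ⟨p, hp, hmax⟩ := (S.filter (· < a)).exists_max_image id
      ⟨x, Finset.mem_filter.2 ⟨hx, hxa⟩⟩
    rw [Finset.mem_filter] at hp
    have hle : ∀ w ∈ S, w < a → w ≤ p := fun w hw hwa => hmax w (Finset.mem_filter.2 ⟨hw, hwa⟩)
    refine ⟨p, hp.1, hp.2, hle, fun w hw hwa => ?_⟩
    rcases (hle w hw hwa).lt_or_eq with h | rfl
    · exact hL a p w h hp.2
    · exact hrefl _ _
  classical
  let T := S.filter fun y => ∃ x ∈ S, x < y ∧ ∀ z ∈ S, z ≠ y → P.pref y x z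
  have hT : T.Nonempty := by
    obtain ⟨u, hu, hmax⟩ := S.exists_max_image id (Finset.card_pos.1 (by omega))
    obtain ⟨x, hx, hxu⟩ := Finset.exists_mem_ne hS u
    obtain ⟨p, hp, hpu, -, hpt⟩ := hpred u x hx (lt_of_le_of_ne (hmax x hx) hxu)
    exact ⟨u, Finset.mem_filter.2 ⟨hu, p, hp, hpu,
      fun z hz hzu => hpt z hz (lt_of_le_of_ne (hmax z hz) hzu)⟩⟩
  obtain ⟨b, hb, hmin⟩ := T.exists_min_image id hT
  obtain ⟨hbS, x, hx, hxb, hxt⟩ := Finset.mem_filter.1 hb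
  obtain ⟨a, ha, hab, hale, hat⟩ := hpred b x hx hxb
  have hright : ∀ w ∈ S, a < w → P.pref a b w := by
    intro w hw haw
    have hbw : b ≤ w := not_lt.1 fun h => (hale w hw h).not_gt haw
    rcases hbw.lt_or_eq with h | rfl
    · exact hR a b w hab h
    · exact hrefl _ _
  refine ⟨a, ha, b, hbS, hab.ne, fun z hz hza => ?_,
    fun z hz hzb => P.pref_trans b a x z (hat x hx hxb) (hxt z hz hzb)⟩
  rcases hza.lt_or_gt with hlt | hgt
  · by_contra hbz
    obtain ⟨p, hp, hpa, -, hpt⟩ := hpred a z hz hlt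
    have hpb : P.pref a p b := P.pref_trans a p z b (hpt z hz hlt)
      ((P.pref_total a z b (hacc _ _) (hacc _ _)).resolve_right hbz)
    refine (hmin a (Finset.mem_filter.2 ⟨ha, p, hp, hpa, fun w hw hwa => ?_⟩)).not_gt hab
    rcases hwa.lt_or_gt with h | h
    · exact hpt w hw h
    · exact P.pref_trans a p b w hpb (hright w hw h)
  · exact hright z hz hgt

/-- If every set of at least two agents contains a mutually top-ranked pair, then every set of
even size has a perfect stable pairing. -/
theorem exists_stable_pairing
    (htop : ∀ S : Finset V, 1 < S.card → ∃ a ∈ S, ∃ b ∈ S, a ≠ b ∧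
      (∀ z ∈ S, z ≠ a → P.pref a b z) ∧ (∀ z ∈ S, z ≠ b → P.pref b a z))
    (n : ℕ) (S : Finset V) (hS : S.card = 2 * n) :
    ∃ f : V → V, (∀ x ∈ S, f x ∈ S ∧ f x ≠ x ∧ f (f x) = x) ∧
      ∀ x ∈ S, ∀ y ∈ S, x ≠ y → P.Strict x y (f x) → ¬ P.Strict y x (f y) := by
  classical
  induction n generalizing S with
  | zero =>
    obtain rfl := Finset.card_eq_zero.1 hS
    exact ⟨id, by simp, by simp⟩
  | succ n ih =>
    obtain ⟨a, ha, b, hb, hab, hta, htb⟩ := htop S (by omega)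
    obtain ⟨f, hf, hst⟩ := ih ((S.erase a).erase b) (by
      rw [Finset.card_erase_of_mem (Finset.mem_erase.2 ⟨hab.symm, hb⟩),
        Finset.card_erase_of_mem ha]
      omega)
    simp only [Finset.mem_erase] at hf hst
    let g : V → V := fun x => if x = a then b else if x = b then a else f x
    have hga : g a = b := if_pos rfl
    have hgb : g b = a := by simp [g, hab.symm]
    have hg : ∀ x, x ≠ a → x ≠ b → g x = f x := fun x h₁ h₂ => by simp [g, h₁, h₂]
    refine ⟨g, fun x hx => ?_, fun x hx y hy hxy hsx hsy => ?_⟩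
    · by_cases hxa : x = a
      · subst hxa
        exact ⟨hga ▸ hb, hga ▸ hab.symm, by rw [hga, hgb]⟩
      by_cases hxb : x = b
      · subst hxb
        exact ⟨hgb ▸ ha, hgb ▸ hab, by rw [hgb, hga]⟩
      obtain ⟨⟨h₁, h₂, h₃⟩, h₄, h₅⟩ := hf x ⟨hxb, hxa, hx⟩
      rw [hg x hxa hxb, hg (f x) h₂ h₁]
      exact ⟨h₃, h₄, h₅⟩
    · have hmatched : ∀ u ∈ S, ∀ v ∈ S, u ≠ v → P.Strict u v (g u) → u ≠ a ∧ u ≠ b := by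
        intro u _ v hv huv hs
        constructor <;> rintro rfl
        · exact hs.not_pref (hga ▸ hta v hv huv.symm)
        · exact hs.not_pref (hgb ▸ htb v hv huv.symm)
      obtain ⟨hxa, hxb⟩ := hmatched x hx y hy hxy hsx
      obtain ⟨hya, hyb⟩ := hmatched y hy x hx hxy.symm hsy
      rw [hg x hxa hxb] at hsx
      rw [hg y hya hyb] at hsy
      exact hst x ⟨hxb, hxa, hx⟩ y ⟨hyb, hya, hy⟩ hxy hsx hsy

theorem SCNoTiesWrt.exists_stable_perfect [Fintype V] {n : ℕ} (hcard : Fintype.card V = 2 * n)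
    (hc : P.IsComplete) (hn : P.Narcissistic) {lt : V → V → Prop} [IsStrictTotalOrder V lt]
    (hsc : P.SCNoTiesWrt lt) : ∃ M : P.Matching, M.Stable ∧ M.Perfect := by
  classical
  have hacc := acc_eq_univ hc hn
  have hbetween : ∀ a y z, lt a y ∧ lt y z ∨ lt z y ∧ lt y a → P.pref a y z :=
    fun _ _ _ => hsc.pref_of_between hacc hn
  let _ : LinearOrder V := linearOrderOfSTO lt
  obtain ⟨f, hf, hst⟩ := exists_stable_pairing
    (fun S hS => exists_mutual_top (P := P) hacc
      (fun a y z h₁ h₂ => hbetween a y z (Or.inl ⟨h₁, h₂⟩))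
      (fun a y z h₁ h₂ => hbetween a y z (Or.inr ⟨h₁, h₂⟩)) hS) n Finset.univ hcard
  simp only [Finset.mem_univ, forall_const, true_and] at hf hst
  refine ⟨⟨fun x => some (f x), ?_, fun x y _ => ⟨hacc _ _, hacc _ _⟩, ?_⟩, ?_, fun x => by simp⟩
  · rintro x _ ⟨⟩
    exact (hf x).1.symm
  · rintro x _ ⟨⟩
    exact congrArg some (hf x).2
  · rintro x y ⟨hxy, -, -, -, hx, hy⟩
    exact hst x y hxy (hx _ rfl) (hy _ rfl)

end Profile

/-- Every complete (possibly with ties), narcissistic and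
single-crossing profile on `2 * n` agents admits a perfect stable matching; the same
holds if the profile is complete, narcissistic and tie-sensitive single-crossing. -/
theorem exists_stable_of_complete_narcissistic_singleCrossing {V : Type*} [Fintype V]
    (n : ℕ) (hcard : Fintype.card V = 2 * n) (P : Profile V)
    (hc : P.IsComplete) (hn : P.Narcissistic) :
    (P.SingleCrossing → ∃ M : P.Matching, M.Stable ∧ M.Perfect) ∧
    (P.TSSingleCrossing → ∃ M : P.Matching, M.Stable ∧ M.Perfect) := by
  exact ⟨fun ⟨_, _, h⟩ => h.scNoTiesWrt.exists_stable_perfect hcard hc hn,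
    fun ⟨_, _, h⟩ => h.scNoTiesWrt.exists_stable_perfect hcard hc hn⟩
end

section
/- The incomplete preference profile without ties on agents {1,…,6} given by: agent 1: 1 ≻ 6 ≻ 5; agent 2: 2 ≻ 5 ≻ 6; agent 3: 3 ≻ 5 ≻ 6; agent 4: 4 ≻ 5 ≻ 6; agent 5: 5 ≻ 1 ≻ 2 ≻ 3 ≻ 4; agent 6: 6 ≻ 4 ≻ 2 ≻ 3 ≻ 1, is narcissistic and single-crossing with respect to the order 1 ▷ 2 ▷ 3 ▷ 4 ▷ 5 ▷ 6, but is not single-peaked with respect to any linear order of the agents. Hence for incomplete preferences without ties, narcissistic and single-crossing preferences are not necessarily single-peaked. -/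
/-- The rank table of the profile (agent `i` is index `i - 1`, `none` means
unacceptable): agent 1: 1 ≻ 6 ≻ 5; agent 2: 2 ≻ 5 ≻ 6; agent 3: 3 ≻ 5 ≻ 6;
agent 4: 4 ≻ 5 ≻ 6; agent 5: 5 ≻ 1 ≻ 2 ≻ 3 ≻ 4; agent 6: 6 ≻ 4 ≻ 2 ≻ 3 ≻ 1. -/
def scNotSpRank : Fin 6 → Fin 6 → Option ℕ :=
  ![![some 0, none, none, none, some 2, some 1],
    ![none, some 0, none, none, some 1, some 2],
    ![none, none, some 0, none, some 1, some 2],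
    ![none, none, none, some 0, some 1, some 2],
    ![some 1, some 2, some 3, some 4, some 0, none],
    ![some 4, some 2, some 3, some 1, none, some 0]]

namespace Profile

variable {V : Type*} (rk : V → V → Option ℕ) (i x y z : V)

theorem mem_acc_ofRank : x ∈ (ofRank rk).acc i ↔ (rk i x).isSome := by
  simp [ofRank, Option.isSome_iff_ne_none]

theorem pref_ofRank_iff :
    (ofRank rk).pref i x y ↔ ∃ a ∈ rk i x, ∃ b ∈ rk i y, a ≤ b := by
  simp only [ofRank, Option.mem_def]
  grind

theorem strict_ofRank_iff :
    (ofRank rk).Strict i x y ↔ ∃ a ∈ rk i x, ∃ b ∈ rk i y, a < b := by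
  simp only [Strict, pref_ofRank_iff, Option.mem_def]
  grind

/-- Along a single-peaked order, a strictly worst alternative of a triple is not the middle one. -/
theorem SinglePeakedWrt.not_between {P : Profile V} {lt : V → V → Prop}
    (h : P.SinglePeakedWrt lt) {i x y z : V} (hxy : P.Strict i x y) (hzy : P.Strict i z y) :
    ¬ (lt x y ∧ lt y z) := fun hlt =>
  hzy.2 (h i x y z (P.pref_mem i x y hxy.1).1 (P.pref_mem i x y hxy.1).2
    (P.pref_mem i z y hzy.1).1 hlt.1 hlt.2 hxy)

end Profile

theorem not_singlePeaked_scNotSpRank : ¬ (Profile.ofRank scNotSpRank).SinglePeaked := by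
  rintro ⟨lt, hlt, h⟩
  have not_between {i x y z : Fin 6}
      (hxy : ∃ a ∈ scNotSpRank i x, ∃ b ∈ scNotSpRank i y, a < b)
      (hzy : ∃ a ∈ scNotSpRank i z, ∃ b ∈ scNotSpRank i y, a < b) :
      ¬ (lt x y ∧ lt y z) ∧ ¬ (lt z y ∧ lt y x) := by
    rw [← Profile.strict_ofRank_iff] at hxy hzy
    exact ⟨h.not_between hxy hzy, h.not_between hzy hxy⟩
  -- Agents 5 and 6 together force agent 2 between any two of agents 1, 3 and 4.
  have separated {x z : Fin 6} (hxz : x ≠ z) (hx : x ≠ 1) (hz : z ≠ 1)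
      (hzmid : ¬ (lt x z ∧ lt z 1) ∧ ¬ (lt 1 z ∧ lt z x))
      (hxmid : ¬ (lt z x ∧ lt x 1) ∧ ¬ (lt 1 x ∧ lt x z)) : lt x 1 ↔ lt 1 z := by
    have := trichotomous_of lt x z
    have := trichotomous_of lt x 1
    have := trichotomous_of lt z 1
    have := asymm_of lt (a := x) (b := 1)
    have := asymm_of lt (a := z) (b := 1)
    tauto
  have h13 : lt 0 1 ↔ lt 1 2 := separated (by decide) (by decide) (by decide)
    (not_between (i := 4) (by decide) (by decide)) (not_between (i := 5) (by decide) (by decide))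
  have h14 : lt 0 1 ↔ lt 1 3 := separated (by decide) (by decide) (by decide)
    (not_between (i := 4) (by decide) (by decide)) (not_between (i := 5) (by decide) (by decide))
  have h34 : lt 2 1 ↔ lt 1 3 := separated (by decide) (by decide) (by decide)
    (not_between (i := 4) (by decide) (by decide)) (not_between (i := 5) (by decide) (by decide))
  have h32 : lt 2 1 ∨ (2 : Fin 6) = 1 ∨ lt 1 2 := trichotomous_of lt 2 1
  have hasymm : lt 2 1 → ¬ lt 1 2 := asymm_of lt
  have hne : (2 : Fin 6) ≠ 1 := by decide
  tauto

/-- The above incomplete profile without ties is narcissistic and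
single-crossing with respect to the natural order `1 ▷ 2 ▷ 3 ▷ 4 ▷ 5 ▷ 6`, but it
is not single-peaked with respect to any linear order of the agents.  Hence for
incomplete preferences without ties, narcissistic and single-crossing preferences
are not necessarily single-peaked. -/
theorem narcissistic_sc_not_sp_example :
    (Profile.ofRank scNotSpRank).NoTies ∧
    (Profile.ofRank scNotSpRank).Narcissistic ∧
    (Profile.ofRank scNotSpRank).SCNoTiesWrt (· < ·) ∧
    ¬ (Profile.ofRank scNotSpRank).SinglePeaked := by
  refine ⟨?_, ?_, ?_, not_singlePeaked_scNotSpRank⟩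
  · simp only [Profile.NoTies, Profile.Indiff, Profile.pref_ofRank_iff]
    decide
  · simp only [Profile.Narcissistic, Profile.mem_acc_ofRank, Profile.strict_ofRank_iff]
    decide
  · simp only [Profile.SCNoTiesWrt, Profile.SetBefore, Profile.prefersSet, Set.mem_ofPred_eq,
      Profile.mem_acc_ofRank, Profile.strict_ofRank_iff]
    decide +kernel
end

section
/- The incomplete preference profile without ties on agents {1,…,6} given by: agent 1: 1 ≻ 5 ≻ 2; agent 2: 2 ≻ 1 ≻ 3; agent 3: 3 ≻ 2 ≻ 4; agent 4: 4 ≻ 3 ≻ 5; agent 5: 5 ≻ 4 ≻ 1 ≻ 6; agent 6: 6 ≻ 5, is narcissistic, single-peaked with respect to the order 3 ▷ 2 ▷ 1 ▷ 4 ▷ 5 ▷ 6, single-crossing, and admits no stable matching. Hence for incomplete preferences without ties, narcissistic, single-peaked, and single-crossing preferences do not guarantee the existence of a stable matching. -/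
/-- The rank table of the profile (agent `i` is index `i - 1`, `none` means
unacceptable): agent 1: 1 ≻ 5 ≻ 2; agent 2: 2 ≻ 1 ≻ 3; agent 3: 3 ≻ 2 ≻ 4;
agent 4: 4 ≻ 3 ≻ 5; agent 5: 5 ≻ 4 ≻ 1 ≻ 6; agent 6: 6 ≻ 5. -/
def noStableRank : Fin 6 → Fin 6 → Option ℕ :=
  ![![some 0, some 2, none, none, some 1, none],
    ![some 1, some 0, some 2, none, none, none],
    ![none, some 1, some 0, some 2, none, none],
    ![none, none, some 1, some 0, some 2, none],
    ![some 2, none, none, some 1, some 0, some 3],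
    ![none, none, none, none, some 1, some 0]]

/-- The single-peaked order `3 ▷ 2 ▷ 1 ▷ 4 ▷ 5 ▷ 6`. -/
def noStableSPOrder (a b : Fin 6) : Prop :=
  (![2, 1, 0, 3, 4, 5] : Fin 6 → Fin 6) a < (![2, 1, 0, 3, 4, 5] : Fin 6 → Fin 6) b

namespace Profile

variable {V : Type*}

instance ofRank_decidable_mem_acc (rk : V → V → Option ℕ) (i x : V) :
    Decidable (x ∈ (ofRank rk).acc i) :=
  inferInstanceAs (Decidable (rk i x ≠ none))

instance ofRank_decidable_pref (rk : V → V → Option ℕ) (i x y : V) :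
    Decidable ((ofRank rk).pref i x y) :=
  decidable_of_iff (∃ a ∈ rk i x, ∃ b ∈ rk i y, a ≤ b) <| by
    simp [ofRank, Option.mem_def]

instance ofRank_decidable_strict (rk : V → V → Option ℕ) (i x y : V) :
    Decidable ((ofRank rk).Strict i x y) :=
  inferInstanceAs (Decidable (_ ∧ ¬ _))

instance ofRank_decidable_indiff (rk : V → V → Option ℕ) (i x y : V) :
    Decidable ((ofRank rk).Indiff i x y) :=
  inferInstanceAs (Decidable (_ ∧ _))

instance ofRank_decidable_mem_prefersSet (rk : V → V → Option ℕ) (i x y : V) :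
    Decidable (i ∈ (ofRank rk).prefersSet x y) :=
  inferInstanceAs (Decidable (_ ∧ _ ∧ _))

/-- In a stable matching, an agent `x` that is the first choice of an acceptable agent `y`
is matched to some agent that `x` does not rank below `y`. -/
theorem Matching.Stable.exists_partner {Q : Profile V} {M : Q.Matching} (hM : M.Stable)
    {x y : V} (hne : x ≠ y) (hy : y ∈ Q.acc x) (hx : x ∈ Q.acc y)
    (htop : ∀ z ∈ Q.acc y, z ≠ y → z ≠ x → Q.Strict y x z) :
    ∃ z, M.m x = some z ∧ z ∈ Q.acc x ∧ x ≠ z ∧ (z = y ∨ ¬ Q.Strict x y z) := by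
  by_contra! h
  have key : ∀ z, M.m x = some z → z ≠ y ∧ Q.Strict x y z := fun z hz =>
    h z hz (M.mutual_acc x z hz).1 (M.ne x z hz)
  refine hM x y ⟨hne, hy, hx, fun h' => (key y h').1 rfl, fun z hz => (key z hz).2, ?_⟩
  intro z hz
  refine htop z (M.mutual_acc y z hz).1 (M.ne y z hz).symm ?_
  rintro rfl
  exact (key y (M.symm y z hz)).1 rfl

end Profile

instance noStableSPOrder_decidableRel : DecidableRel noStableSPOrder := fun _ _ =>
  inferInstanceAs (Decidable (_ < _))

theorem noStableRank_singleCrossing :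
    (Profile.ofRank noStableRank).SCNoTiesWrt (· < ·) := by
  unfold Profile.SCNoTiesWrt Profile.SetBefore
  decide +kernel

theorem noStableRank_singlePeaked :
    (Profile.ofRank noStableRank).SinglePeakedWrt noStableSPOrder := by
  unfold Profile.SinglePeakedWrt
  decide +kernel

theorem noStableRank_not_stable (M : (Profile.ofRank noStableRank).Matching) :
    ¬ M.Stable := by
  intro hM
  have partner : ∀ x y a b : Fin 6,
      (x ≠ y ∧ y ∈ (Profile.ofRank noStableRank).acc x ∧
        x ∈ (Profile.ofRank noStableRank).acc y ∧
        ∀ z ∈ (Profile.ofRank noStableRank).acc y, z ≠ y → z ≠ x →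
          (Profile.ofRank noStableRank).Strict y x z) →
      (∀ z ∈ (Profile.ofRank noStableRank).acc x, x ≠ z →
        (z = y ∨ ¬ (Profile.ofRank noStableRank).Strict x y z) → z = a ∨ z = b) →
      M.m x = some a ∨ M.m x = some b := by
    rintro x y a b ⟨hne, hy, hx, htop⟩ hab
    obtain ⟨z, hz, hacc, hxz, hzy⟩ := hM.exists_partner hne hy hx htop
    rcases hab z hacc hxz hzy with rfl | rfl
    · exact Or.inl hz
    · exact Or.inr hz
  have h0 := partner 0 1 4 1 (by decide +kernel) (by decide +kernel)
  have h1 := partner 1 2 0 2 (by decide +kernel) (by decide +kernel)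
  have h2 := partner 2 3 1 3 (by decide +kernel) (by decide +kernel)
  have h3 := partner 3 4 2 4 (by decide +kernel) (by decide +kernel)
  have h4 := partner 4 0 3 0 (by decide +kernel) (by decide +kernel)
  have excl : ∀ a b c : Fin 6, b ≠ c → M.m a = some b → M.m c ≠ some a := fun a b c hbc hab hca =>
    hbc (Option.some_injective _ (hab.symm.trans (M.symm c a hca)))
  rcases h0 with h04 | h01
  · have h12 := h1.resolve_left (excl 0 4 1 (by decide) h04)
    have h34 := h3.resolve_left (excl 2 1 3 (by decide) (M.symm 1 2 h12))
    exact excl 4 3 0 (by decide) (M.symm 3 4 h34) h04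
  · have h23 := h2.resolve_left (excl 1 0 2 (by decide) (M.symm 0 1 h01))
    have h40 := h4.resolve_left (excl 3 2 4 (by decide) (M.symm 2 3 h23))
    exact excl 0 1 4 (by decide) h01 h40

/-- The above incomplete profile without ties is narcissistic,
single-peaked w.r.t. `3 ▷ 2 ▷ 1 ▷ 4 ▷ 5 ▷ 6`, single-crossing, yet it admits no
stable matching.  Hence existence of stable matchings is not guaranteed. -/
theorem no_stable_matching_example :
    (Profile.ofRank noStableRank).NoTies ∧
    (Profile.ofRank noStableRank).Narcissistic ∧
    (Profile.ofRank noStableRank).SinglePeakedWrt noStableSPOrder ∧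
    (∃ lt : Fin 6 → Fin 6 → Prop, IsStrictTotalOrder (Fin 6) lt ∧
      (Profile.ofRank noStableRank).SCNoTiesWrt lt) ∧
    ∀ M : (Profile.ofRank noStableRank).Matching, ¬ M.Stable := by
  refine ⟨?_, ?_, noStableRank_singlePeaked,
    ⟨(· < ·), inferInstance, noStableRank_singleCrossing⟩, noStableRank_not_stable⟩
  · unfold Profile.NoTies
    decide +kernel
  · unfold Profile.Narcissistic
    decide +kernel
end

section
/- Let P be a preference profile on an agent set containing A = {a^1, a^2, a^3, a^4, a^5} and a nonempty set X of agents disjoint from A, in which the agents of A have the following preferences: a^1: a^1 ≻ a^5 ≻ a^2; a^2: a^2 ≻ a^1 ≻ a^3; a^3: a^3 ≻ a^2 ≻ a^4; a^4: a^4 ≻ a^3 ≻ a^5; a^5: a^5 ≻ (X) ≻ a^4 ≻ a^1, where (X) means that all agents of X are tied with each other in a^5's preference order (so by symmetry of acceptability every agent of X finds a^5 acceptable). Then every stable matching M of P satisfies M(a^5) ∈ X, M(a^1) = a^2, and M(a^3) = a^4. -/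
/-- **selector gadget.** With the preferences of the agents
`a¹, …, a⁵` as specified (`a⁵` being tied between all members of the nonempty set
`X`), every stable matching `M` satisfies `M(a⁵) ∈ X`, `M(a¹) = a²` and
`M(a³) = a⁴`. -/
theorem selector_gadget {V : Type*} (P : Profile V) (hsymm : P.AccSymm)
    (a1 a2 a3 a4 a5 : V) (X : Set V)
    (hX : X.Nonempty)
    (hdisj : ∀ v ∈ X, v ∉ ({a1, a2, a3, a4, a5} : Set V))
    (hdist : List.Pairwise (· ≠ ·) [a1, a2, a3, a4, a5])
    (acc1 : P.acc a1 = {a1, a5, a2})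
    (h1a : P.Strict a1 a1 a5) (h1b : P.Strict a1 a5 a2)
    (acc2 : P.acc a2 = {a2, a1, a3})
    (h2a : P.Strict a2 a2 a1) (h2b : P.Strict a2 a1 a3)
    (acc3 : P.acc a3 = {a3, a2, a4})
    (h3a : P.Strict a3 a3 a2) (h3b : P.Strict a3 a2 a4)
    (acc4 : P.acc a4 = {a4, a3, a5})
    (h4a : P.Strict a4 a4 a3) (h4b : P.Strict a4 a3 a5)
    (acc5 : P.acc a5 = insert a5 (X ∪ {a4, a1}))
    (h5a : ∀ x ∈ X, P.Strict a5 a5 x)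
    (h5b : ∀ x ∈ X, ∀ x' ∈ X, P.Indiff a5 x x')
    (h5c : ∀ x ∈ X, P.Strict a5 x a4)
    (h5d : P.Strict a5 a4 a1)
    (M : P.Matching) (hM : M.Stable) :
    (∃ x ∈ X, M.m a5 = some x) ∧ M.m a1 = some a2 ∧ M.m a3 = some a4 := by
  simp only [List.pairwise_cons, List.mem_cons, List.not_mem_nil, or_false,
    forall_eq_or_imp, forall_eq] at hdist
  obtain ⟨⟨n12, n13, n14, n15⟩, ⟨n23, n24, n25⟩, ⟨n34, n35⟩, n45, -⟩ := hdist
  have o1 : M.m a1 = none ∨ M.m a1 = some a5 ∨ M.m a1 = some a2 := by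
    rcases h : M.m a1 with _ | y
    · simp
    · have := M.ne _ _ h
      have := (M.mutual_acc _ _ h).1
      rw [acc1] at this
      grind
  have o2 : M.m a2 = none ∨ M.m a2 = some a1 ∨ M.m a2 = some a3 := by
    rcases h : M.m a2 with _ | y
    · simp
    · have := M.ne _ _ h
      have := (M.mutual_acc _ _ h).1
      rw [acc2] at this
      grind
  have o3 : M.m a3 = none ∨ M.m a3 = some a2 ∨ M.m a3 = some a4 := by
    rcases h : M.m a3 with _ | y
    · simp
    · have := M.ne _ _ h
      have := (M.mutual_acc _ _ h).1
      rw [acc3] at this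
      grind
  have o4 : M.m a4 = none ∨ M.m a4 = some a3 ∨ M.m a4 = some a5 := by
    rcases h : M.m a4 with _ | y
    · simp
    · have := M.ne _ _ h
      have := (M.mutual_acc _ _ h).1
      rw [acc4] at this
      grind
  have o5 : M.m a5 = none ∨ (∃ x ∈ X, M.m a5 = some x) ∨ M.m a5 = some a4 ∨
      M.m a5 = some a1 := by
    rcases h : M.m a5 with _ | y
    · simp
    · have := M.ne _ _ h
      have := (M.mutual_acc _ _ h).1
      rw [acc5] at this
      grind
  have b12 : ¬ ((M.m a1 = none) ∧ (M.m a2 = none ∨ M.m a2 = some a3)) := fun h =>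
    hM a1 a2 ⟨n12, by simp [acc1], by simp [acc2], by grind, by grind, by grind⟩
  have b23 : ¬ ((M.m a2 = none) ∧ (M.m a3 = none ∨ M.m a3 = some a4)) := fun h =>
    hM a2 a3 ⟨n23, by simp [acc2], by simp [acc3], by grind, by grind, by grind⟩
  have b34 : ¬ ((M.m a3 = none) ∧ (M.m a4 = none ∨ M.m a4 = some a5)) := fun h =>
    hM a3 a4 ⟨n34, by simp [acc3], by simp [acc4], by grind, by grind, by grind⟩
  have b45 : ¬ ((M.m a4 = none) ∧ (M.m a5 = none ∨ M.m a5 = some a1)) := fun h =>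
    hM a4 a5 ⟨n45, by simp [acc4], by simp [acc5], by grind, by grind, by grind⟩
  have b51 : ¬ ((M.m a5 = none) ∧ (M.m a1 = none ∨ M.m a1 = some a2)) := fun h =>
    hM a5 a1 ⟨n15.symm, by simp [acc5], by simp [acc1], by grind, by grind, by grind⟩
  have hs := M.symm
  have s12 := hs a1 a2
  have s21 := hs a2 a1
  have s23 := hs a2 a3
  have s32 := hs a3 a2
  have s34 := hs a3 a4
  have s43 := hs a4 a3
  have s45 := hs a4 a5
  have s54 := hs a5 a4
  have s51 := hs a5 a1
  have s15 := hs a1 a5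
  clear hs
  grind
end

section
/- Let A = {a^1, a^2, a^3, a^4, a^5} be agents with the preferences a^1: a^1 ≻ a^5 ≻ a^2; a^2: a^2 ≻ a^1 ≻ a^3; a^3: a^3 ≻ a^2 ≻ a^4; a^4: a^4 ≻ a^3 ≻ a^5; a^5: a^5 ≻ (X) ≻ a^4 ≻ a^1, where X is a nonempty set of agents disjoint from A and (X) means all agents of X are tied in a^5's order. Then: (i) these preferences are narcissistic and are single-peaked with respect to the linear order a^3 ▷ a^2 ▷ a^1 ▷ a^4 ▷ a^5 ▷ [X], where [X] is any fixed linear order of X, and (ii) these preferences are tie-sensitive single-crossing with respect to every linear order of the agents in A (extended by [X]). -/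
namespace Profile

variable {V : Type*} {P : Profile V}

theorem Strict.trans {i x y z : V} (hxy : P.Strict i x y) (hyz : P.Strict i y z) :
    P.Strict i x z :=
  ⟨P.pref_trans _ _ _ _ hxy.1 hyz.1, fun h => hyz.2 (P.pref_trans _ _ _ _ h hxy.1)⟩

theorem Strict.asymm {i x y : V} (hxy : P.Strict i x y) : ¬ P.Strict i y x :=
  fun h => h.2 hxy.1

/-- A narcissistic collection in which only the members of a pair `{x, y}` themselves can
share the comparison of `x` and `y` is tie-sensitive single-crossing for every linear order. -/
theorem NarcissisticOn.tsSingleCrossingWrtOn {S : Set V} {lt : V → V → Prop}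
    [IsStrictTotalOrder V lt] (hS : P.NarcissisticOn S)
    (hshare : ∀ i ∈ S, ∀ j ∈ S, i ≠ j → ∀ x ∈ P.acc i ∩ P.acc j, ∀ y ∈ P.acc i ∩ P.acc j,
      x ≠ y → (i = x ∧ j = y) ∨ (i = y ∧ j = x)) :
    P.TSSingleCrossingWrtOn S lt := by
  have no_ties {x y i j : V} (hxy : x ≠ y) (hi : i ∈ P.prefersSetOn S x y)
      (hj : j ∈ P.tiesSetOn S x y) : False := by
    obtain ⟨hiS, hix, hiy, hi⟩ := hi
    obtain ⟨hjS, hjx, hjy, hj⟩ := hj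
    have hij : i ≠ j := by
      rintro rfl
      exact hi.2 hj.2
    rcases hshare i hiS j hjS hij x ⟨hix, hjx⟩ y ⟨hiy, hjy⟩ hxy with ⟨-, rfl⟩ | ⟨-, rfl⟩
    · exact ((hS _ hjS).2 x hjx hxy).2 hj.1
    · exact ((hS _ hjS).2 y hjy hxy.symm).2 hj.2
  have crossing {x y i j : V} (hxy : x ≠ y) (hi : i ∈ P.prefersSetOn S x y)
      (hj : j ∈ P.prefersSetOn S y x) : i = x ∧ j = y := by
    obtain ⟨hiS, hix, hiy, hi⟩ := hi
    obtain ⟨hjS, hjy, hjx, hj⟩ := hj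
    have hij : i ≠ j := by
      rintro rfl
      exact hi.asymm hj
    rcases hshare i hiS j hjS hij x ⟨hix, hjx⟩ y ⟨hiy, hjy⟩ hxy with h | ⟨rfl, -⟩
    · exact h
    · exact absurd ((hS _ hiS).2 x hix hxy) hi.asymm
  have ties_comm {x y i : V} (hi : i ∈ P.tiesSetOn S x y) : i ∈ P.tiesSetOn S y x :=
    ⟨hi.1, hi.2.2.1, hi.2.1, hi.2.2.2.symm⟩
  intro x y hxy
  rcases trichotomous_of lt x y with h | h | h
  · refine Or.inl ⟨fun i hi j hj => (no_ties hxy hi hj).elim,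
      fun i hi j hj => (no_ties hxy.symm hj (ties_comm hi)).elim, fun i hi j hj => ?_⟩
    obtain ⟨rfl, rfl⟩ := crossing hxy hi hj
    exact h
  · exact absurd h hxy
  · refine Or.inr ⟨fun i hi j hj => (no_ties hxy.symm hi (ties_comm hj)).elim,
      fun i hi j hj => (no_ties hxy hj hi).elim, fun i hi j hj => ?_⟩
    obtain ⟨rfl, rfl⟩ := crossing hxy.symm hi hj
    exact h

end Profile

/-- **structure of the selector gadget.** With the preferences of
`a¹, …, a⁵` as specified (`a⁵` being tied between all members of the nonempty set
`X` disjoint from `{a¹, …, a⁵}`): (i) these preferences are narcissistic and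
single-peaked w.r.t. every linear order of the form
`a³ ▷ a² ▷ a¹ ▷ a⁴ ▷ a⁵ ▷ [X]` (the agents of `X` ordered arbitrarily at the end),
and (ii) they are tie-sensitive single-crossing w.r.t. every linear order in which
the agents of `{a¹, …, a⁵}` precede the agents of `X`. -/
theorem selector_gadget_structured {V : Type*} (P : Profile V) (hsymm : P.AccSymm)
    (a1 a2 a3 a4 a5 : V) (X : Set V)
    (hX : X.Nonempty)
    (hdisj : ∀ v ∈ X, v ∉ ({a1, a2, a3, a4, a5} : Set V))
    (hdist : List.Pairwise (· ≠ ·) [a1, a2, a3, a4, a5])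
    (acc1 : P.acc a1 = {a1, a5, a2})
    (h1a : P.Strict a1 a1 a5) (h1b : P.Strict a1 a5 a2)
    (acc2 : P.acc a2 = {a2, a1, a3})
    (h2a : P.Strict a2 a2 a1) (h2b : P.Strict a2 a1 a3)
    (acc3 : P.acc a3 = {a3, a2, a4})
    (h3a : P.Strict a3 a3 a2) (h3b : P.Strict a3 a2 a4)
    (acc4 : P.acc a4 = {a4, a3, a5})
    (h4a : P.Strict a4 a4 a3) (h4b : P.Strict a4 a3 a5)
    (acc5 : P.acc a5 = insert a5 (X ∪ {a4, a1}))
    (h5a : ∀ x ∈ X, P.Strict a5 a5 x)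
    (h5b : ∀ x ∈ X, ∀ x' ∈ X, P.Indiff a5 x x')
    (h5c : ∀ x ∈ X, P.Strict a5 x a4)
    (h5d : P.Strict a5 a4 a1) :
    P.NarcissisticOn {a1, a2, a3, a4, a5} ∧
    (∀ lt : V → V → Prop, IsStrictTotalOrder V lt →
      lt a3 a2 → lt a2 a1 → lt a1 a4 → lt a4 a5 → (∀ x ∈ X, lt a5 x) →
      P.SinglePeakedWrtOn {a1, a2, a3, a4, a5} lt) ∧
    (∀ lt : V → V → Prop, IsStrictTotalOrder V lt →
      (∀ v ∈ ({a1, a2, a3, a4, a5} : Set V), ∀ x ∈ X, lt v x) →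
      P.TSSingleCrossingWrtOn {a1, a2, a3, a4, a5} lt) := by
  have hnarc : P.NarcissisticOn {a1, a2, a3, a4, a5} := by
    obtain ⟨x₀, hx₀⟩ := hX
    have h1c := h1a.trans h1b
    have h2c := h2a.trans h2b
    have h3c := h3a.trans h3b
    have h4c := h4a.trans h4b
    have h5e := (h5a x₀ hx₀).trans (h5c x₀ hx₀)
    have h5f := h5e.trans h5d
    rintro i (rfl | rfl | rfl | rfl | rfl)
    all_goals
      simp only [acc1, acc2, acc3, acc4, acc5, Set.mem_insert_iff, Set.mem_union,
        Set.mem_singleton_iff]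
      grind
  simp only [List.pairwise_cons, List.mem_cons, forall_eq_or_imp, List.not_mem_nil] at hdist
  simp only [Set.mem_insert_iff, Set.mem_singleton_iff] at hdisj
  refine ⟨hnarc, fun lt _ h32 h21 h14 h45 h5X => ?_, fun lt _ _ => ?_⟩
  · have tr {x y z : V} : lt x y → lt y z → lt x z := _root_.trans
    have as {x y : V} : lt x y → ¬ lt y x := asymm
    have h31 := tr h32 h21
    have h34 := tr h31 h14
    have h15 := tr h14 h45
    rintro i (rfl | rfl | rfl | rfl | rfl) x y z hx hy hz hxy hyz hs
    all_goals
      simp only [acc1, acc2, acc3, acc4, acc5, Set.mem_insert_iff, Set.mem_union,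
        Set.mem_singleton_iff] at hx hy hz
      grind [Profile.Strict, Profile.Indiff]
  · refine hnarc.tsSingleCrossingWrtOn ?_
    rintro i (rfl | rfl | rfl | rfl | rfl) j (rfl | rfl | rfl | rfl | rfl) hij x ⟨hxi, hxj⟩
      y ⟨hyi, hyj⟩ hxy
    all_goals
      simp only [acc1, acc2, acc3, acc4, acc5, Set.mem_insert_iff, Set.mem_union,
        Set.mem_singleton_iff] at hxi hxj hyi hyj
      grind
end

section
/- Let X = {x^1,…,x^{10}}, R = {r^2, r^4, r^6, r^8}, A, and B be pairwise disjoint sets of agents, where the agents of X have the preferences: x^1: x^1 ≻ x^{10} ≻ [A] ≻ x^2; x^2: x^2 ≻ x^1 ≻ r^2 ≻ x^3; x^3: x^3 ≻ x^2 ≻ x^4; x^4: x^4 ≻ x^3 ≻ r^4 ≻ x^5; x^5: x^5 ≻ x^4 ≻ x^6; x^6: x^6 ≻ x^5 ≻ r^6 ≻ x^7; x^7: x^7 ≻ x^6 ≻ x^8; x^8: x^8 ≻ x^7 ≻ r^8 ≻ x^9; x^9: x^9 ≻ x^8 ≻ x^{10}; x^{10}: x^{10} ≻ x^9 ≻ [B]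 ≻ x^1, where [A] and [B] denote fixed linear orders of A and B. If M is a stable matching of a preference profile containing these agents with these preferences and M(x^{10}) ∈ B, then {x^9, x^8} ∈ M, {x^7, x^6} ∈ M, {x^5, x^4} ∈ M, and {x^3, x^2} ∈ M. -/
namespace Profile

variable {V : Type*} {P : Profile V}

/-- If `w` prefers `y` to its partner in a stable matching and `y` accepts only `p` and `w`
besides itself, then `y` is matched with `p`. -/
theorem Matching.Stable.eq_some_of_strict {M : P.Matching} (hM : M.Stable) {y p w z : V}
    (hyw : y ≠ w) (hacc : P.acc y = {y, p, w}) (hwz : M.m w = some z) (hw : P.Strict w y z) :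
    M.m y = some p := by
  have hne : M.m y ≠ some w := by
    intro h
    obtain rfl : z = y := Option.some_inj.mp (hwz.symm.trans (M.symm y w h))
    exact hw.2 hw.1
  cases hy : M.m y with
  | none =>
    refine absurd ⟨hyw, by simp [hacc], (P.pref_mem _ _ _ hw.1).1, hne, ?_, ?_⟩ (hM y w)
    · intro q hq
      simp [hy] at hq
    · intro q hq
      rwa [← Option.some_inj.mp (hwz.symm.trans hq)]
  | some q =>
    have hq := (M.mutual_acc y q hy).1
    rw [hacc] at hq
    rcases hq with rfl | rfl | rfl
    · exact absurd rfl (M.ne _ _ hy)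
    · rfl
    · exact absurd hy hne

end Profile

/-- **vertex gadget.** With the preferences of `x¹, …, x¹⁰` as
specified, every stable matching `M` with `M(x¹⁰) ∈ B` matches `x⁹` with `x⁸`,
`x⁷` with `x⁶`, `x⁵` with `x⁴`, and `x³` with `x²`. -/
theorem vertex_gadget {V : Type*} (P : Profile V) (hsymm : P.AccSymm)
    (x1 x2 x3 x4 x5 x6 x7 x8 x9 x10 r2 r4 r6 r8 : V) (A B : Set V)
    (hdist : List.Pairwise (· ≠ ·) [x1, x2, x3, x4, x5, x6, x7, x8, x9, x10, r2, r4, r6, r8])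
    (hA : ∀ a ∈ A, a ∉ B ∧ ∀ v ∈ [x1, x2, x3, x4, x5, x6, x7, x8, x9, x10, r2, r4, r6, r8], a ≠ v)
    (hB : ∀ b ∈ B, ∀ v ∈ [x1, x2, x3, x4, x5, x6, x7, x8, x9, x10, r2, r4, r6, r8], b ≠ v)
    (acc1 : P.acc x1 = insert x1 (insert x10 (A ∪ {x2})))
    (h1a : P.Strict x1 x1 x10)
    (h1b : ∀ a ∈ A, P.Strict x1 x10 a)
    (h1c : ∀ a ∈ A, ∀ a' ∈ A, a ≠ a' → ¬ P.Indiff x1 a a')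
    (h1d : ∀ a ∈ A, P.Strict x1 a x2)
    (acc2 : P.acc x2 = {x2, x1, r2, x3})
    (h2a : P.Strict x2 x2 x1) (h2b : P.Strict x2 x1 r2) (h2c : P.Strict x2 r2 x3)
    (acc3 : P.acc x3 = {x3, x2, x4})
    (h3a : P.Strict x3 x3 x2) (h3b : P.Strict x3 x2 x4)
    (acc4 : P.acc x4 = {x4, x3, r4, x5})
    (h4a : P.Strict x4 x4 x3) (h4b : P.Strict x4 x3 r4) (h4c : P.Strict x4 r4 x5)
    (acc5 : P.acc x5 = {x5, x4, x6})
    (h5a : P.Strict x5 x5 x4) (h5b : P.Strict x5 x4 x6)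
    (acc6 : P.acc x6 = {x6, x5, r6, x7})
    (h6a : P.Strict x6 x6 x5) (h6b : P.Strict x6 x5 r6) (h6c : P.Strict x6 r6 x7)
    (acc7 : P.acc x7 = {x7, x6, x8})
    (h7a : P.Strict x7 x7 x6) (h7b : P.Strict x7 x6 x8)
    (acc8 : P.acc x8 = {x8, x7, r8, x9})
    (h8a : P.Strict x8 x8 x7) (h8b : P.Strict x8 x7 r8) (h8c : P.Strict x8 r8 x9)
    (acc9 : P.acc x9 = {x9, x8, x10})
    (h9a : P.Strict x9 x9 x8) (h9b : P.Strict x9 x8 x10)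
    (acc10 : P.acc x10 = insert x10 (insert x9 (B ∪ {x1})))
    (h10a : P.Strict x10 x10 x9)
    (h10b : ∀ b ∈ B, P.Strict x10 x9 b)
    (h10c : ∀ b ∈ B, ∀ b' ∈ B, b ≠ b' → ¬ P.Indiff x10 b b')
    (h10d : ∀ b ∈ B, P.Strict x10 b x1)
    (M : P.Matching) (hM : M.Stable)
    (hB10 : ∃ b ∈ B, M.m x10 = some b) :
    M.m x9 = some x8 ∧ M.m x7 = some x6 ∧ M.m x5 = some x4 ∧ M.m x3 = some x2 := by
  simp only [List.pairwise_cons, List.mem_cons, forall_eq_or_imp] at hdist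
  obtain ⟨b, hb, hmb⟩ := hB10
  have m9 : M.m x9 = some x8 :=
    hM.eq_some_of_strict (by tauto) acc9 hmb (h10b b hb)
  have m7 : M.m x7 = some x6 :=
    hM.eq_some_of_strict (by tauto) acc7 (M.symm _ _ m9) (h8b.trans h8c)
  have m5 : M.m x5 = some x4 :=
    hM.eq_some_of_strict (by tauto) acc5 (M.symm _ _ m7) (h6b.trans h6c)
  have m3 : M.m x3 = some x2 :=
    hM.eq_some_of_strict (by tauto) acc3 (M.symm _ _ m5) (h4b.trans h4c)
  exact ⟨m9, m7, m5, m3⟩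
end
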